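/- Let q be a prime power, R = 𝔽_q[X], K = 𝔽_q(X), let L/K be a finite separable extension of degree n, let S be the integral closure of R in L, and let c ∈ R be a nonconstant polynomial. Then the set of nonzero α ∈ S with Norm_{L/K}(α) ∈ c·𝔽_q^×, considered up to the equivalence of being associate in S, is finite, and the number of equivalence classes (i.e., the number of non-associate solutions of the norm equation Norm_{L/K}(α) = c up to constants in 𝔽_q^×) is at most 2^{n·deg c}. -/

import Mathlib

open scoped Polynomial

set_option synthInstance.maxHeartbeats 1000000
set_option maxHeartbeats 1000000

/-- The set of solutions of the norm equation `Norm_{L/K}(α) = c` up to constants in `Fq^×`: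
nonzero elements `α` of the integral closure `S` of `Fq[X]` in `L` whose field norm lies in
`c · Fq^×`. -/
def NormEqSolutions (Fq : Type*) [Field Fq] [Fintype Fq]
    (L : Type*) [Field L] [Algebra Fq[X] L] [Algebra (RatFunc Fq) L]
    [IsScalarTower Fq[X] (RatFunc Fq) L] (c : Fq[X]) : Type _ :=
  {α : FunctionField.ringOfIntegers Fq L // α ≠ 0 ∧
    ∃ ζ : Fqˣ, Algebra.norm (RatFunc Fq) (α : L) =
      algebraMap Fq[X] (RatFunc Fq) (Polynomial.C (ζ : Fq) * c)}

/-- A principal ideal of `F[X]` generated by `d ≠ 0` is a product of at most `d.natDegree`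
proper ideals. -/
theorem card_le_natDegree_of_prod_eq_span {F : Type*} [Field F] (s : Multiset (Ideal F[X]))
    (hs : ∀ J ∈ s, J ≠ ⊤) {d : F[X]} (hd : d ≠ 0) (h : s.prod = Ideal.span {d}) :
    Multiset.card s ≤ d.natDegree := by
  induction s using Multiset.induction_on generalizing d with
  | empty => simp
  | cons J t ih =>
    obtain ⟨g, rfl⟩ := (inferInstance : J.IsPrincipal)
    obtain ⟨e, he⟩ := (inferInstance : t.prod.IsPrincipal)
    rw [Ideal.submodule_span_eq] at he hs h
    rw [Multiset.prod_cons, he, Ideal.span_singleton_mul_span_singleton,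
      Ideal.span_singleton_eq_span_singleton] at h
    have hge : g * e ≠ 0 := h.ne_zero_iff.mpr hd
    have hg : g.natDegree ≠ 0 := fun h0 ↦
      hs _ (Multiset.mem_cons_self _ _) <| Ideal.span_singleton_eq_top.mpr <|
        Polynomial.isUnit_iff_degree_eq_zero.mpr <| by
          rw [Polynomial.degree_eq_natDegree (left_ne_zero_of_mul hge), h0, Nat.cast_zero]
    have hdeg : (g * e).natDegree = d.natDegree :=
      Polynomial.natDegree_eq_of_degree_eq (Polynomial.degree_eq_degree_of_associated h)
    rw [Polynomial.natDegree_mul (left_ne_zero_of_mul hge) (right_ne_zero_of_mul hge)] at hdeg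
    have := ih (fun I hI ↦ hs I (Multiset.mem_cons_of_mem hI)) (right_ne_zero_of_mul hge) he
    rw [Multiset.card_cons]
    omega

open UniqueFactorizationMonoid in
/-- In a finite extension `S` of `F[X]` of degree `n`, the ideal `cS` has at most `n * deg c`
prime factors, counted with multiplicity. -/
theorem card_normalizedFactors_span_algebraMap_le {F : Type*} [Field F] {S : Type*} [CommRing S]
    [IsDedekindDomain S] [Algebra F[X] S] [Module.Finite F[X] S] [Module.IsTorsionFree F[X] S]
    (K L : Type*) [Field K] [Field L] [Algebra F[X] K] [IsFractionRing F[X] K] [Algebra K L]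
    [Algebra F[X] L] [IsScalarTower F[X] K L] [Algebra S L] [IsScalarTower F[X] S L]
    [IsIntegralClosure S F[X] L] [FiniteDimensional K L] {c : F[X]} (hc : c ≠ 0) :
    Multiset.card (normalizedFactors (Ideal.span {algebraMap F[X] S c})) ≤
      Module.finrank K L * c.natDegree := by
  have hnorm : Algebra.intNorm F[X] S (algebraMap F[X] S c) = c ^ Module.finrank K L := by
    apply FaithfulSMul.algebraMap_injective F[X] K
    rw [Algebra.algebraMap_intNorm (L := L), ← IsScalarTower.algebraMap_apply,
      IsScalarTower.algebraMap_apply F[X] K L, Algebra.norm_algebraMap, map_pow]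
  have hI : Ideal.span {algebraMap F[X] S c} ≠ 0 := by
    rw [Ideal.zero_eq_bot, Ne, Ideal.span_singleton_eq_bot,
      FaithfulSMul.algebraMap_eq_zero_iff]
    exact hc
  rw [← Polynomial.natDegree_pow,
    ← Multiset.card_map (Ideal.relNorm F[X]) (normalizedFactors _)]
  refine card_le_natDegree_of_prod_eq_span _ (fun J hJ ↦ ?_) (pow_ne_zero _ hc) ?_
  · obtain ⟨P, hP, rfl⟩ := Multiset.mem_map.mp hJ
    intro htop
    have hle := Ideal.relNorm_le_comap F[X] P
    rw [htop, top_le_iff, Ideal.comap_eq_top_iff] at hle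
    exact (prime_of_normalized_factor P hP).not_isUnit (Ideal.isUnit_iff.mpr hle)
  · rw [Multiset.prod_hom, Ideal.prod_normalizedFactors_eq_self hI, Ideal.relNorm_singleton, hnorm]

open UniqueFactorizationMonoid in
/-- Up to associates, a nonzero element `a` of a Dedekind domain has at most `2 ^ m` divisors,
where `m` is the number of prime factors of the ideal generated by `a`. -/
theorem finite_and_card_quot_associated_le {S : Type*} [CommRing S] [IsDedekindDomain S] {a : S}
    (ha : a ≠ 0) (p : S → Prop) (hp : ∀ x, p x → x ∣ a) :
    Finite (Quot fun x y : {x // p x} ↦ Associated x.1 y.1) ∧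
      Nat.card (Quot fun x y : {x // p x} ↦ Associated x.1 y.1) ≤
        2 ^ Multiset.card (normalizedFactors (Ideal.span {a})) := by
  classical
  have hspan {x : S} (hx : x ≠ 0) : Ideal.span {x} ≠ 0 := by
    rwa [Ideal.zero_eq_bot, Ne, Ideal.span_singleton_eq_bot]
  have hne {x : S} (hx : p x) : x ≠ 0 := ne_zero_of_dvd_ne_zero ha (hp x hx)
  let T := (normalizedFactors (Ideal.span {a})).powerset.toFinset
  let f : (Quot fun x y : {x // p x} ↦ Associated x.1 y.1) → T :=
    Quot.lift
      (fun x ↦ ⟨normalizedFactors (Ideal.span {x.1}), by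
        rw [Multiset.mem_toFinset, Multiset.mem_powerset,
          ← dvd_iff_normalizedFactors_le_normalizedFactors (hspan (hne x.2)) (hspan ha),
          Ideal.dvd_iff_le, Ideal.span_singleton_le_span_singleton]
        exact hp _ x.2⟩)
      (fun x y h ↦ Subtype.ext <|
        congrArg normalizedFactors (Ideal.span_singleton_eq_span_singleton.mpr h))
  have hf : Function.Injective f := by
    rintro ⟨x⟩ ⟨y⟩ h
    apply Quot.sound
    have h' : normalizedFactors (Ideal.span {x.1}) = normalizedFactors (Ideal.span {y.1}) :=
      congrArg Subtype.val h
    rw [← Ideal.span_singleton_eq_span_singleton,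
      ← Ideal.prod_normalizedFactors_eq_self (hspan (hne x.2)), h',
      Ideal.prod_normalizedFactors_eq_self (hspan (hne y.2))]
  refine ⟨Finite.of_injective f hf, (Nat.card_le_card_of_injective f hf).trans ?_⟩
  rw [Nat.card_eq_fintype_card, Fintype.card_coe, ← Multiset.card_powerset]
  exact Multiset.toFinset_card_le _

/-- Let `Fq` be a finite field with `q` elements, `R = Fq[X]`, `K = Fq(X)`, let `L/K` be a finite
separable extension of degree `n`, `S` the integral closure of `R` in `L` and `c ∈ R` a
nonconstant polynomial. Then the set of nonzero `α ∈ S` with `Norm_{L/K}(α) ∈ c·Fq^×`,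
considered up to associateness in `S`, is finite, with at most `2 ^ (n · deg c)` classes. -/
theorem stmt_9 (Fq : Type*) [Field Fq] [Fintype Fq]
    (L : Type*) [Field L] [Algebra Fq[X] L] [Algebra (RatFunc Fq) L]
    [IsScalarTower Fq[X] (RatFunc Fq) L]
    [FiniteDimensional (RatFunc Fq) L] [Algebra.IsSeparable (RatFunc Fq) L]
    (c : Fq[X]) (hc : 0 < c.natDegree) :
    Finite (Quot (fun a b : NormEqSolutions Fq L c => Associated a.1 b.1)) ∧
      Nat.card (Quot (fun a b : NormEqSolutions Fq L c => Associated a.1 b.1)) ≤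
        2 ^ (Module.finrank (RatFunc Fq) L * c.natDegree) := by
  have hc0 : c ≠ 0 := by
    rintro rfl
    simp at hc
  have : Module.Finite Fq[X] (FunctionField.ringOfIntegers Fq L) :=
    Module.IsNoetherian.finite _ _
  have : FaithfulSMul Fq[X] (FunctionField.ringOfIntegers Fq L) :=
    (faithfulSMul_iff_algebraMap_injective _ _).mpr
      (FunctionField.ringOfIntegers.algebraMap_injective Fq L)
  have : Module.IsTorsionFree Fq[X] (FunctionField.ringOfIntegers Fq L) := inferInstance
  have ha : algebraMap Fq[X] (FunctionField.ringOfIntegers Fq L) c ≠ 0 :=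
    (map_ne_zero_iff _ (FunctionField.ringOfIntegers.algebraMap_injective Fq L)).mpr hc0
  obtain ⟨hfin, hcard⟩ := finite_and_card_quot_associated_le ha
    (fun α : FunctionField.ringOfIntegers Fq L ↦ α ≠ 0 ∧
      ∃ ζ : Fqˣ, Algebra.norm (RatFunc Fq) (α : L) =
        algebraMap Fq[X] (RatFunc Fq) (Polynomial.C (ζ : Fq) * c)) <| by
    rintro α ⟨-, ζ, hζ⟩
    have hnorm : Algebra.intNorm Fq[X] (FunctionField.ringOfIntegers Fq L) α =
        Polynomial.C (ζ : Fq) * c := by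
      apply FaithfulSMul.algebraMap_injective Fq[X] (RatFunc Fq)
      rw [Algebra.algebraMap_intNorm (L := L), ← hζ]
      rfl
    have hdvd := Algebra.dvd_algebraMap_intNorm_self Fq[X] _ α
    rw [hnorm, map_mul] at hdvd
    exact (((ζ.isUnit.map Polynomial.C).map (algebraMap Fq[X] _)).dvd_mul_left).mp hdvd
  exact ⟨hfin, hcard.trans <| Nat.pow_le_pow_right two_pos <|
    card_normalizedFactors_span_algebraMap_le (RatFunc Fq) L hc0⟩
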